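/- Let T be a positive integer, 0 ≤ θ < 1, 0 ≤ ρ < 1, Σ_θ the T×T matrix with entries θ^{|t−τ|} assumed positive definite, and for each t let n_t be a positive integer and 0 ≤ k_t < n_t. Let g : (0,1) → ℝ satisfy Φ(g(λ)) = λ for all λ ∈ (0,1), and define P_λ[X₁=k₁,…,X_T=k_T] = ∫_{ℝ^T} φ_{Σ_θ}(s) ∏_{t=1}^{T} C(n_t,k_t) G(λ,ρ,s_t)^{k_t} (1−G(λ,ρ,s_t))^{n_t−k_t} ds, with G(λ,ρ,y) = Φ((g(λ) − √ρ·y)/√(1−ρ)). Then for a ∈ {0,1} the integral ∫_0^1 λ^a · P_λ[X₁=k₁,…,X_T=k_T] / (1−λ) dλ is finite; in particular the multi-period conservative Bayesian estimator λ₁* = (∫_0^1 λ·P_λ[X₁=k₁,…,X_T=k_T]/(1−λ) dλ) / (∫_0^1 P_λ[X₁=k₁,…,X_T=k_T]/(1−λ) dλ) is well defined. -/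

import Mathlib

open MeasureTheory Real

/-- Standard normal density `φ`. -/
noncomputable def stdNormalPDF (s : ℝ) : ℝ := Real.exp (-s ^ 2 / 2) / Real.sqrt (2 * π)

/-- Standard normal cumulative distribution function `Φ`. -/
noncomputable def stdNormalCDF (q : ℝ) : ℝ := ∫ t in Set.Iic q, stdNormalPDF t

/-- The `T×T` time-correlation matrix `Σ_θ` with entries `θ^{|t−τ|}`. -/
noncomputable def timeCorrMatrix (T : ℕ) (θ : ℝ) : Matrix (Fin T) (Fin T) ℝ :=
  Matrix.of fun t τ => θ ^ ((t : ℤ) - (τ : ℤ)).natAbs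

/-- Density `φ_Σ` of the centered multivariate normal distribution on `ℝ^T` with
(invertible) covariance matrix `Σ`. -/
noncomputable def mvNormalPDF {T : ℕ} (Sig : Matrix (Fin T) (Fin T) ℝ)
    (s : Fin T → ℝ) : ℝ :=
  Real.exp (-(∑ t, ∑ τ, s t * Sig⁻¹ t τ * s τ) / 2) / Real.sqrt ((2 * π) ^ T * Sig.det)

/-- Unconditional multi-period probability `P_λ[X₁ = k₁, …, X_T = k_T]` of observing
`k t` defaults among `nt t` borrowers in each year `t`, in the multi-period one-factor
Gaussian model with time correlation `θ`, asset correlation `ρ`, long-run PD `λ`, and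
`g = Φ⁻¹`. -/
noncomputable def multiPeriodProb (T : ℕ) (θ ρ : ℝ) (nt k : Fin T → ℕ)
    (g : ℝ → ℝ) (lam : ℝ) : ℝ :=
  ∫ s : Fin T → ℝ, mvNormalPDF (timeCorrMatrix T θ) s *
    ∏ t : Fin T, ((nt t).choose (k t) : ℝ) *
      stdNormalCDF ((g lam - Real.sqrt ρ * s t) / Real.sqrt (1 - ρ)) ^ (k t) *
      (1 - stdNormalCDF ((g lam - Real.sqrt ρ * s t) / Real.sqrt (1 - ρ))) ^ (nt t - k t)

open ProbabilityTheory Matrix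

lemma stdNormalPDF_eq (s : ℝ) : stdNormalPDF s = gaussianPDFReal 0 1 s := by
  simp [stdNormalPDF, gaussianPDFReal, div_eq_inv_mul]

lemma stdNormalCDF_eq (q : ℝ) : stdNormalCDF q = (gaussianReal 0 1).real (Set.Iic q) := by
  rw [measureReal_def, gaussianReal_apply_eq_integral 0 one_ne_zero, ENNReal.toReal_ofReal]
  · simp [stdNormalCDF, stdNormalPDF_eq]
  · exact integral_nonneg fun x => gaussianPDFReal_nonneg _ _ _

lemma one_sub_stdNormalCDF_eq (q : ℝ) :
    1 - stdNormalCDF q = (gaussianReal 0 1).real (Set.Ioi q) := by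
  rw [stdNormalCDF_eq, ← Set.compl_Iic, probReal_compl_eq_one_sub measurableSet_Iic]

lemma ofReal_one_sub_stdNormalCDF (q : ℝ) :
    ENNReal.ofReal (1 - stdNormalCDF q) = gaussianReal 0 1 (Set.Ioi q) := by
  rw [one_sub_stdNormalCDF_eq, ofReal_measureReal]

lemma stdNormalCDF_mono : Monotone stdNormalCDF := by
  intro a b h
  rw [stdNormalCDF_eq, stdNormalCDF_eq]
  exact measureReal_mono (Set.Iic_subset_Iic.2 h)

lemma stdNormalCDF_nonneg (q : ℝ) : 0 ≤ stdNormalCDF q := by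
  rw [stdNormalCDF_eq]; positivity

lemma stdNormalCDF_le_one (q : ℝ) : stdNormalCDF q ≤ 1 := by
  have := one_sub_stdNormalCDF_eq q
  have h : 0 ≤ (gaussianReal 0 1).real (Set.Ioi q) := by positivity
  linarith

lemma measurable_stdNormalCDF : Measurable stdNormalCDF := stdNormalCDF_mono.measurable

lemma conv_lemma (ρ : ℝ) (hρ0 : 0 ≤ ρ) (hρ1 : ρ < 1) (x : ℝ) :
    ∫⁻ y, ENNReal.ofReal (1 - stdNormalCDF ((x - √ρ * y) / √(1 - ρ))) ∂(gaussianReal 0 1)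
      = ENNReal.ofReal (1 - stdNormalCDF x) := by
  have h1 : (gaussianReal 0 1).map (√ρ * ·) = gaussianReal 0 (NNReal.mk ρ hρ0) := by
    rw [gaussianReal_map_const_mul]
    congr 1
    · simp
    · ext; simp [Real.sq_sqrt hρ0]
  have h2 : (gaussianReal 0 1).map (√(1 - ρ) * ·) = gaussianReal 0 (NNReal.mk (1 - ρ) (by linarith)) := by
    rw [gaussianReal_map_const_mul]
    congr 1
    · simp
    · ext; simp [Real.sq_sqrt (show 0 ≤ 1 - ρ by linarith)]
  have hpos : 0 < √(1 - ρ) := Real.sqrt_pos.2 (by linarith)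
  have h3 : ((gaussianReal 0 1).map (√ρ * ·)).conv ((gaussianReal 0 1).map (√(1 - ρ) * ·))
      = gaussianReal 0 1 := by
    rw [h1, h2, gaussianReal_conv_gaussianReal]
    congr 1
    · simp
    · ext; simp
  rw [ofReal_one_sub_stdNormalCDF]
  conv_rhs => rw [← h3]
  rw [← lintegral_indicator_one measurableSet_Ioi]
  have hm : Measurable ((Set.Ioi x).indicator (1 : ℝ → ENNReal)) :=
    measurable_one.indicator measurableSet_Ioi
  rw [Measure.lintegral_conv hm, lintegral_map (by
    refine Measurable.lintegral_prod_right' (f := fun p : ℝ × ℝ => (Set.Ioi x).indicator (1 : ℝ → ENNReal) (p.1 + p.2)) ?_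
    exact hm.comp (measurable_fst.add measurable_snd)) (by fun_prop)]
  refine lintegral_congr fun y => ?_
  have hm2 : Measurable fun z => (Set.Ioi x).indicator (1 : ℝ → ENNReal) (√ρ * y + z) :=
    hm.comp (by fun_prop)
  rw [lintegral_map hm2 (by fun_prop), ofReal_one_sub_stdNormalCDF,
    ← lintegral_indicator_one measurableSet_Ioi]
  refine lintegral_congr fun z => ?_
  have : z ∈ Set.Ioi ((x - √ρ * y) / √(1 - ρ)) ↔ √ρ * y + √(1 - ρ) * z ∈ Set.Ioi x := by
    simp only [Set.mem_Ioi, div_lt_iff₀ hpos]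
    constructor <;> intro h <;> linarith
  by_cases hz : z ∈ Set.Ioi ((x - √ρ * y) / √(1 - ρ))
  · rw [Set.indicator_of_mem hz, Set.indicator_of_mem (this.1 hz)]; rfl
  · rw [Set.indicator_of_notMem hz, Set.indicator_of_notMem (fun h => hz (this.2 h))]

lemma exists_eps {m : ℕ} (A : Matrix (Fin m) (Fin m) ℝ) (hA : A.PosDef) :
    ∃ ε > 0, ∀ r : Fin m → ℝ, ε * ∑ i, r i ^ 2 ≤ r ⬝ᵥ (A *ᵥ r) := by
  have hcont : Continuous fun r : Fin m → ℝ => r ⬝ᵥ (A *ᵥ r) := by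
    unfold dotProduct mulVec dotProduct; fun_prop
  obtain ⟨c, hc, h⟩ : ∃ c > 0, ∀ r ∈ Metric.sphere (0 : Fin m → ℝ) 1, c ≤ r ⬝ᵥ (A *ᵥ r) := by
    by_cases hne : (Metric.sphere (0 : Fin m → ℝ) 1).Nonempty
    · obtain ⟨r0, hr0, hmin⟩ := (isCompact_sphere (0 : Fin m → ℝ) 1).exists_isMinOn hne
        hcont.continuousOn
      refine ⟨_, ?_, fun r hr => hmin hr⟩
      have : r0 ≠ 0 := by rintro rfl; simp at hr0
      simpa using hA.dotProduct_mulVec_pos this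
    · exact ⟨1, one_pos, fun r hr => (hne ⟨r, hr⟩).elim⟩
  refine ⟨c / (m + 1), by positivity, fun r => ?_⟩
  by_cases hr : r = 0
  · simp [hr]
  have hn : 0 < ‖r‖ := norm_pos_iff.2 hr
  have h1 := h (‖r‖⁻¹ • r) (by simp [norm_smul, hn.ne'])
  rw [mulVec_smul, dotProduct_smul, smul_dotProduct, smul_eq_mul, smul_eq_mul] at h1
  have h2 : c * ‖r‖ ^ 2 ≤ r ⬝ᵥ (A *ᵥ r) := by
    have := mul_le_mul_of_nonneg_right h1 (sq_nonneg ‖r‖)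
    field_simp at this
    linarith
  have h3 : ∑ i, r i ^ 2 ≤ (m + 1) * ‖r‖ ^ 2 := by
    calc ∑ i, r i ^ 2 ≤ ∑ i : Fin m, ‖r‖ ^ 2 := by
          refine Finset.sum_le_sum fun i _ => ?_
          rw [← sq_abs]
          exact pow_le_pow_left₀ (abs_nonneg _) (norm_le_pi_norm r i) 2
      _ ≤ _ := by simp; nlinarith [sq_nonneg ‖r‖]
  calc c / (m + 1) * ∑ i, r i ^ 2 ≤ c / (m + 1) * ((m + 1) * ‖r‖ ^ 2) := by gcongr
    _ = c * ‖r‖ ^ 2 := by field_simp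
    _ ≤ _ := h2

lemma quad_lower {n : ℕ} (S : Matrix (Fin (n + 1)) (Fin (n + 1)) ℝ) (hS : S.PosDef)
    (h00 : S 0 0 = 1) :
    ∃ ε > 0, ∀ s : Fin (n + 1) → ℝ,
      s 0 ^ 2 + ε * ∑ i : Fin n, (s i.succ - s 0 * S i.succ 0) ^ 2 ≤ s ⬝ᵥ (S⁻¹ *ᵥ s) := by
  obtain ⟨ε, hε, h⟩ := exists_eps _ hS.inv
  refine ⟨ε, hε, fun s => ?_⟩
  set c : Fin (n + 1) → ℝ := S *ᵥ Pi.single 0 1 with hc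
  have hci : ∀ i, c i = S i 0 := fun i => by simp [hc]
  have hdet : IsUnit S.det := (Matrix.isUnit_iff_isUnit_det S).1 hS.isUnit
  have hic : S⁻¹ *ᵥ c = Pi.single 0 1 := by
    rw [hc, mulVec_mulVec, nonsing_inv_mul _ hdet, one_mulVec]
  have hsymm : ∀ u v : Fin (n + 1) → ℝ, u ⬝ᵥ (S⁻¹ *ᵥ v) = v ⬝ᵥ (S⁻¹ *ᵥ u) := by
    intro u v
    have : S⁻¹ᵀ = S⁻¹ := by simpa using hS.inv.isHermitian.eq
    rw [dotProduct_mulVec, ← mulVec_transpose, this, dotProduct_comm]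
  set r := s - s 0 • c with hr
  have hs : s = s 0 • c + r := by simp [hr]
  have hr0 : r 0 = 0 := by simp [hr, hci, h00]
  have key : s ⬝ᵥ (S⁻¹ *ᵥ s) = s 0 ^ 2 + r ⬝ᵥ (S⁻¹ *ᵥ r) := by
    have e1 : c ⬝ᵥ (S⁻¹ *ᵥ c) = 1 := by rw [hic]; simp [hci, h00]
    have e2 : r ⬝ᵥ (S⁻¹ *ᵥ c) = 0 := by rw [hic]; simp [hr0]
    have e3 : c ⬝ᵥ (S⁻¹ *ᵥ r) = 0 := by rw [hsymm, e2]
    generalize s 0 = a at hs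
    rw [hs]
    simp only [mulVec_add, mulVec_smul, dotProduct_add, add_dotProduct, smul_dotProduct,
      dotProduct_smul, e1, e2, e3, smul_eq_mul]
    ring
  have h2 := h r
  rw [Fin.sum_univ_succ, hr0] at h2
  rw [key]
  have : ∀ i : Fin n, r i.succ = s i.succ - s 0 * S i.succ 0 := fun i => by simp [hr, hci]
  simp only [this] at h2
  linarith

lemma marginal_bound {n : ℕ} (S : Matrix (Fin (n + 1)) (Fin (n + 1)) ℝ) (hS : S.PosDef)
    (h00 : S 0 0 = 1) :
    ∃ C : ENNReal, C ≠ ⊤ ∧ ∀ f : ℝ → ENNReal, Measurable f →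
      ∫⁻ s : Fin (n + 1) → ℝ, ENNReal.ofReal (mvNormalPDF S s) * f (s 0)
        ≤ C * ∫⁻ y, f y ∂(gaussianReal 0 1) := by
  obtain ⟨ε, hε, h⟩ := quad_lower S hS h00
  let D : ℝ := √((2 * π) ^ (n + 1) * S.det)
  let q : (Fin n → ℝ) → ENNReal := fun r => ENNReal.ofReal (∏ i, Real.exp (-(ε / 2) * r i ^ 2))
  have hqm : Measurable q := by fun_prop
  have hq : ∫⁻ r, q r ≠ ⊤ := by
    have : Integrable (fun r : Fin n → ℝ => ∏ i, Real.exp (-(ε / 2) * r i ^ 2)) :=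
      Integrable.fintype_prod (f := fun _ (x : ℝ) => Real.exp (-(ε / 2) * x ^ 2))
        (fun i => integrable_exp_neg_mul_sq (by positivity))
    have := this.lintegral_lt_top
    exact this.ne
  let K : ENNReal := ENNReal.ofReal (√(2 * π) / D)
  refine ⟨K * ∫⁻ r, q r, ENNReal.mul_ne_top ENNReal.ofReal_ne_top hq, fun f hf => ?_⟩
  let F : ℝ × (Fin n → ℝ) → ENNReal := fun p =>
    K * (gaussianPDF 0 1 p.1 * f p.1 * q (fun i => p.2 i - p.1 * S i.succ 0))
  have hFm : Measurable F := by
    have : Measurable fun p : ℝ × (Fin n → ℝ) => q (fun i => p.2 i - p.1 * S i.succ 0) :=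
      hqm.comp (by fun_prop)
    have h2 : Measurable fun p : ℝ × (Fin n → ℝ) => f p.1 := hf.comp measurable_fst
    have h3 : Measurable fun p : ℝ × (Fin n → ℝ) => gaussianPDF 0 1 p.1 :=
      (measurable_gaussianPDF 0 1).comp measurable_fst
    exact ((h3.mul h2).mul this).const_mul _
  have hmp := volume_preserving_piFinSuccAbove (fun _ : Fin (n + 1) => ℝ) 0
  calc ∫⁻ s : Fin (n + 1) → ℝ, ENNReal.ofReal (mvNormalPDF S s) * f (s 0)
      ≤ ∫⁻ s : Fin (n + 1) → ℝ,
          F (MeasurableEquiv.piFinSuccAbove (fun _ : Fin (n + 1) => ℝ) 0 s) := by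
        refine lintegral_mono fun s => ?_
        have hb : mvNormalPDF S s ≤ (√(2 * π) / D) * (gaussianPDFReal 0 1 (s 0) *
            ∏ i : Fin n, Real.exp (-(ε / 2) * (s i.succ - s 0 * S i.succ 0) ^ 2)) := by
          rw [← Real.exp_sum, ← Finset.mul_sum]
          have hD : 0 ≤ D := Real.sqrt_nonneg _
          have h2 : 0 < √(2 * π) := by positivity
          have e : (√(2 * π) / D) * (gaussianPDFReal 0 1 (s 0) *
            Real.exp (-(ε / 2) * ∑ i : Fin n, (s i.succ - s 0 * S i.succ 0) ^ 2)) =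
            Real.exp (-(s 0 ^ 2 + ε * ∑ i : Fin n, (s i.succ - s 0 * S i.succ 0) ^ 2) / 2) / D := by
            rw [gaussianPDFReal]
            simp only [sub_zero, NNReal.coe_one, mul_one]
            rw [show -(s 0 ^ 2 + ε * ∑ i : Fin n, (s i.succ - s 0 * S i.succ 0) ^ 2) / 2
              = -s 0 ^ 2 / 2 + -(ε / 2) * ∑ i : Fin n, (s i.succ - s 0 * S i.succ 0) ^ 2 by ring,
              Real.exp_add]
            field_simp
          rw [e]
          unfold mvNormalPDF
          have hs := h s
          have hs' : s ⬝ᵥ (S⁻¹ *ᵥ s) = ∑ t, ∑ τ, s t * S⁻¹ t τ * s τ := by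
            simp [dotProduct, mulVec, Finset.mul_sum, mul_assoc]
          rw [hs'] at hs
          change _ / D ≤ _
          gcongr
        calc ENNReal.ofReal (mvNormalPDF S s) * f (s 0) ≤ ENNReal.ofReal ((√(2 * π) / D) *
              (gaussianPDFReal 0 1 (s 0) * ∏ i : Fin n,
                Real.exp (-(ε / 2) * (s i.succ - s 0 * S i.succ 0) ^ 2))) * f (s 0) := by
              gcongr
          _ = _ := by
            rw [ENNReal.ofReal_mul (by positivity), ENNReal.ofReal_mul (gaussianPDFReal_nonneg _ _ _)]
            simp only [F, K, q, gaussianPDF, MeasurableEquiv.piFinSuccAbove_apply]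
            simp [Fin.tail, mul_assoc, mul_comm, mul_left_comm]
    _ = ∫⁻ p, F p := hmp.lintegral_comp hFm
    _ = ∫⁻ y, ∫⁻ r, F (y, r) := by
        rw [Measure.volume_eq_prod, lintegral_prod _ hFm.aemeasurable]
    _ = ∫⁻ y, K * (gaussianPDF 0 1 y * f y * ∫⁻ r, q r) := by
        refine lintegral_congr fun y => ?_
        have hq2 : Measurable fun r : Fin n → ℝ => q (fun i => r i - y * S i.succ 0) :=
          hqm.comp (by fun_prop)
        simp only [F]
        rw [lintegral_const_mul _ (hq2.const_mul _), lintegral_const_mul _ hq2]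
        congr 2
        exact lintegral_sub_right_eq_self q (fun i => y * S i.succ 0)
    _ = K * (∫⁻ r, q r) * ∫⁻ y, f y ∂(gaussianReal 0 1) := by
        rw [gaussianReal_of_var_ne_zero 0 one_ne_zero,
          lintegral_withDensity_eq_lintegral_mul _ (measurable_gaussianPDF 0 1) hf]
        have hm := (measurable_gaussianPDF 0 1).mul hf
        rw [← lintegral_const_mul _ hm]
        refine lintegral_congr fun y => ?_
        simp only [Pi.mul_apply]
        ring

lemma prob_bound (n : ℕ) (θ ρ : ℝ) (hρ0 : 0 ≤ ρ) (hρ1 : ρ < 1)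
    (hSig : (timeCorrMatrix (n + 1) θ).PosDef)
    (nt k : Fin (n + 1) → ℕ) (hk : ∀ t, k t < nt t) (g : ℝ → ℝ) :
    ∃ C : ℝ, 0 ≤ C ∧ ∀ lam, |multiPeriodProb (n + 1) θ ρ nt k g lam|
      ≤ C * (1 - stdNormalCDF (g lam)) := by
  obtain ⟨C, hC, h⟩ := marginal_bound _ hSig (by simp [timeCorrMatrix])
  let B : ℝ := ∏ t, ((nt t).choose (k t) : ℝ)
  have hB : 0 ≤ B := Finset.prod_nonneg fun _ _ => by positivity
  refine ⟨B * C.toReal, by positivity, fun lam => ?_⟩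
  have h1 := fun q => sub_nonneg.2 (stdNormalCDF_le_one q)
  let G : ℝ → ℝ := fun y => stdNormalCDF ((g lam - √ρ * y) / √(1 - ρ))
  have hG0 : ∀ y, 0 ≤ G y := fun y => stdNormalCDF_nonneg _
  have hG1 : ∀ y, 0 ≤ 1 - G y := fun y => h1 _
  have hGm : Measurable G := measurable_stdNormalCDF.comp (by fun_prop)
  have hmv : ∀ s, 0 ≤ mvNormalPDF (timeCorrMatrix (n + 1) θ) s := fun s => by
    unfold mvNormalPDF; positivity
  have hprod : ∀ s : Fin (n + 1) → ℝ, ∏ t, ((nt t).choose (k t) : ℝ) * G (s t) ^ (k t) *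
      (1 - G (s t)) ^ (nt t - k t) ≤ B * (1 - G (s 0)) := by
    intro s
    simp only [B]
    rw [Fin.prod_univ_succ, Fin.prod_univ_succ, mul_right_comm (_ : ℝ) _ (1 - G (s 0))]
    have hle : ∀ t, G (s t) ^ (k t) ≤ 1 := fun t =>
      pow_le_one₀ (hG0 _) (by linarith [hG1 (s t)])
    have hle2 : ∀ t, (1 - G (s t)) ^ (nt t - k t) ≤ 1 - G (s t) := fun t =>
      pow_le_of_le_one (hG1 _) (by linarith [hG0 (s t)]) (by have := hk t; omega)
    have hnn : ∀ t, 0 ≤ ((nt t).choose (k t) : ℝ) * G (s t) ^ (k t) *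
      (1 - G (s t)) ^ (nt t - k t) := fun t =>
        mul_nonneg (mul_nonneg (by positivity) (pow_nonneg (hG0 _) _)) (pow_nonneg (hG1 _) _)
    apply mul_le_mul
    · calc _ ≤ ((nt 0).choose (k 0) : ℝ) * 1 * (1 - G (s 0)) := by
            apply mul_le_mul _ (hle2 0) (pow_nonneg (hG1 _) _) (by positivity)
            exact mul_le_mul_of_nonneg_left (hle 0) (by positivity)
        _ = _ := by ring
    · apply Finset.prod_le_prod
      · intro i _; exact hnn _
      · intro i _
        calc _ ≤ ((nt i.succ).choose (k i.succ) : ℝ) * 1 * 1 := by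
              apply mul_le_mul _ _ (pow_nonneg (hG1 _) _) (by positivity)
              · exact mul_le_mul_of_nonneg_left (hle _) (by positivity)
              · exact (hle2 _).trans (by linarith [hG0 (s i.succ)])
          _ = _ := by ring
    · exact Finset.prod_nonneg fun _ _ => hnn _
    · exact mul_nonneg (by positivity) (hG1 _)
  have hnn : ∀ s : Fin (n + 1) → ℝ, 0 ≤ ∏ t, ((nt t).choose (k t) : ℝ) * G (s t) ^ (k t) *
      (1 - G (s t)) ^ (nt t - k t) := fun s => Finset.prod_nonneg fun t _ =>
        mul_nonneg (mul_nonneg (by positivity) (pow_nonneg (hG0 _) _)) (pow_nonneg (hG1 _) _)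
  have key : ‖multiPeriodProb (n + 1) θ ρ nt k g lam‖ₑ ≤
      ENNReal.ofReal (B * C.toReal * (1 - stdNormalCDF (g lam))) := by
    refine (enorm_integral_le_lintegral_enorm _).trans ?_
    calc _ ≤ ∫⁻ s : Fin (n + 1) → ℝ, ENNReal.ofReal (mvNormalPDF (timeCorrMatrix (n + 1) θ) s) *
            (ENNReal.ofReal B * ENNReal.ofReal (1 - G (s 0))) := by
          refine lintegral_mono fun s => ?_
          rw [← ENNReal.ofReal_mul hB, ← ENNReal.ofReal_mul (hmv s),
            Real.enorm_of_nonneg (mul_nonneg (hmv s) (hnn s))]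
          exact ENNReal.ofReal_le_ofReal (mul_le_mul_of_nonneg_left (hprod s) (hmv s))
      _ ≤ C * ∫⁻ y, ENNReal.ofReal B * ENNReal.ofReal (1 - G y) ∂(gaussianReal 0 1) :=
          h (fun y => ENNReal.ofReal B * ENNReal.ofReal (1 - G y)) (by fun_prop)
      _ = C * (ENNReal.ofReal B * ENNReal.ofReal (1 - stdNormalCDF (g lam))) := by
          rw [lintegral_const_mul _ (by fun_prop), ← conv_lemma ρ hρ0 hρ1 (g lam)]
      _ = _ := by
          rw [ENNReal.ofReal_mul (by positivity), ENNReal.ofReal_mul hB, ENNReal.ofReal_toReal hC]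
          ring
  rw [Real.enorm_eq_ofReal_abs] at key
  exact (ENNReal.ofReal_le_ofReal_iff (mul_nonneg (by positivity) (h1 _))).1 key

lemma prob_aemeas (T : ℕ) (θ ρ : ℝ) (nt k : Fin T → ℕ)
    (g : ℝ → ℝ) (hg : ∀ lam ∈ Set.Ioo (0:ℝ) 1, stdNormalCDF (g lam) = lam) :
    AEMeasurable (multiPeriodProb T θ ρ nt k g) (volume.restrict (Set.Ioo 0 1)) := by
  have hgm : AEMeasurable g (volume.restrict (Set.Ioo 0 1)) := by
    apply aemeasurable_restrict_of_monotoneOn measurableSet_Ioo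
    intro a ha b hb hab
    by_contra! hlt
    have := stdNormalCDF_mono hlt.le
    rw [hg a ha, hg b hb] at this
    have : a = b := le_antisymm hab this
    subst this
    exact lt_irrefl _ hlt
  have hs : StronglyMeasurable (fun x : ℝ => multiPeriodProb T θ ρ nt k (fun _ => x) 0) := by
    unfold multiPeriodProb
    apply StronglyMeasurable.integral_prod_right
    apply Measurable.stronglyMeasurable
    have hmv : Measurable fun p : ℝ × (Fin T → ℝ) => mvNormalPDF (timeCorrMatrix T θ) p.2 := by
      unfold mvNormalPDF; fun_prop
    refine hmv.mul (Finset.measurable_prod _ fun t _ => ?_)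
    have hc : Measurable fun p : ℝ × (Fin T → ℝ) =>
        stdNormalCDF ((p.1 - √ρ * p.2 t) / √(1 - ρ)) :=
      measurable_stdNormalCDF.comp (by fun_prop)
    exact ((hc.pow_const _).const_mul _).mul ((hc.const_sub 1).pow_const _)
  exact hs.measurable.comp_aemeasurable hgm

/-- In the multi-period one-factor Gaussian model, for `a ∈ {0,1}` the
function `λ ↦ λ^a P_λ[X₁=k₁,…,X_T=k_T]/(1−λ)` is integrable on `(0,1)`; in particular
the multi-period conservative Bayesian estimator (the posterior mean for the improper
prior with density `1/(1−λ)`) is well defined. -/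
theorem multiperiod_conservative_bayesian_integrals_finite (T : ℕ) (hT : 0 < T)
    (θ ρ : ℝ) (hθ0 : 0 ≤ θ) (hθ1 : θ < 1) (hρ0 : 0 ≤ ρ) (hρ1 : ρ < 1)
    (hSig : (timeCorrMatrix T θ).PosDef)
    (nt k : Fin T → ℕ) (hnt : ∀ t, 0 < nt t) (hk : ∀ t, k t < nt t)
    (g : ℝ → ℝ) (hg : ∀ lam ∈ Set.Ioo (0:ℝ) 1, stdNormalCDF (g lam) = lam) :
    ∀ a : ℕ, a = 0 ∨ a = 1 →
      IntegrableOn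
        (fun lam : ℝ => lam ^ a * multiPeriodProb T θ ρ nt k g lam / (1 - lam))
        (Set.Ioo 0 1) volume := by
  intro a _
  obtain ⟨n, rfl⟩ : ∃ n, T = n + 1 := ⟨T - 1, by omega⟩
  obtain ⟨C, hC, h⟩ := prob_bound n θ ρ hρ0 hρ1 hSig nt k hk g
  have hm := prob_aemeas (n + 1) θ ρ nt k g hg
  refine Integrable.of_bound ?_ C ?_
  · apply AEMeasurable.aestronglyMeasurable
    have h1 : AEMeasurable (fun lam : ℝ => lam ^ a) (volume.restrict (Set.Ioo 0 1)) := by fun_prop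
    have h2 : AEMeasurable (fun lam : ℝ => 1 - lam) (volume.restrict (Set.Ioo 0 1)) := by fun_prop
    exact (h1.mul hm).div h2
  · refine (ae_restrict_iff' measurableSet_Ioo).2 (Filter.Eventually.of_forall fun lam hl => ?_)
    have hb := h lam
    rw [hg lam hl] at hb
    have hp : 0 < 1 - lam := by linarith [hl.2]
    rw [Real.norm_eq_abs, abs_div, abs_mul, abs_of_pos hp, div_le_iff₀ hp,
      abs_of_nonneg (pow_nonneg hl.1.le a)]
    calc _ ≤ 1 * |multiPeriodProb (n + 1) θ ρ nt k g lam| := by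
          gcongr; exact pow_le_one₀ hl.1.le hl.2.le
      _ ≤ _ := by rw [one_mul]; exact hb
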